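/- Let f, g_1, …, g_s ∈ ℝ[Y_1,…,Y_n], S = {y : g_1(y) ≥ 0, …, g_s(y) ≥ 0}, f* = inf{ f(y) : y ∈ S } with −∞ < f* < ∞, and D_f = deg f. If f̂ is strictly positive on Ŝ, then f̃* = f*, where f̃* = sup{ x ∈ ℝ : f^h(ỹ) − x y_0^{D_f} ≥ 0 for all ỹ ∈ S̃ }; moreover the sum-of-squares relaxation values f̃^sos_k = sup{ x : f^h(Ỹ) − x Y_0^{D_f} ∈ Q_k(G^h) } converge to f* as k → ∞. -/

import Mathlib

open MvPolynomial

/-- A polynomial is a sum of squares. -/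
def SOSPoly {n : ℕ} (p : MvPolynomial (Fin n) ℝ) : Prop :=
  ∃ (t : ℕ) (q : Fin t → MvPolynomial (Fin n) ℝ), p = ∑ i, q i ^ 2

/-- Membership in the quadratic module Q(G) generated by `g`. -/
def QModMem {n s : ℕ} (g : Fin s → MvPolynomial (Fin n) ℝ)
    (p : MvPolynomial (Fin n) ℝ) : Prop :=
  ∃ (σ₀ : MvPolynomial (Fin n) ℝ) (σ : Fin s → MvPolynomial (Fin n) ℝ),
    SOSPoly σ₀ ∧ (∀ j, SOSPoly (σ j)) ∧ p = σ₀ + ∑ j, σ j * g j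

/-- The basic semialgebraic index set S. -/
def indexSet {n s : ℕ} (g : Fin s → MvPolynomial (Fin n) ℝ) : Set (Fin n → ℝ) :=
  {y | ∀ j, 0 ≤ eval y (g j)}

/-- Feasibility for the LSIPP problem (P): a(y)ᵀx + b(y) ≥ 0 for all y ∈ S. -/
def isFeasible {n m s : ℕ} (a : Fin m → MvPolynomial (Fin n) ℝ)
    (b : MvPolynomial (Fin n) ℝ) (g : Fin s → MvPolynomial (Fin n) ℝ)
    (x : Fin m → ℝ) : Prop :=
  ∀ y ∈ indexSet g, 0 ≤ (∑ i, x i * eval y (a i)) + eval y b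

/-- Homogenization of `f` to degree `D` with respect to the new variable Y₀
(the variable of index 0; the original variables Y_i become the variables of
index i.succ). -/
noncomputable def polyHomog {n : ℕ} (D : ℕ) (f : MvPolynomial (Fin n) ℝ) :
    MvPolynomial (Fin (n + 1)) ℝ :=
  ∑ α ∈ f.support,
    MvPolynomial.monomial
      (Finsupp.single (0 : Fin (n + 1)) (D - ∑ i, α i) + Finsupp.mapDomain Fin.succ α)
      (f.coeff α)

/-- The set S̃_> = {ỹ : g_j^h(ỹ) ≥ 0, y₀ > 0, ‖ỹ‖² = 1}. -/
def tildeSPos {n s : ℕ} (g : Fin s → MvPolynomial (Fin n) ℝ) :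
    Set (Fin (n + 1) → ℝ) :=
  {y | (∀ j, 0 ≤ eval y (polyHomog (g j).totalDegree (g j))) ∧ 0 < y 0 ∧
    ∑ i, y i ^ 2 = 1}

/-- The set S̃ = {ỹ : g_j^h(ỹ) ≥ 0, y₀ ≥ 0, ‖ỹ‖² = 1}. -/
def tildeS {n s : ℕ} (g : Fin s → MvPolynomial (Fin n) ℝ) :
    Set (Fin (n + 1) → ℝ) :=
  {y | (∀ j, 0 ≤ eval y (polyHomog (g j).totalDegree (g j))) ∧ 0 ≤ y 0 ∧
    ∑ i, y i ^ 2 = 1}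

/-- The set Ŝ = {y : ĝ_j(y) ≥ 0, ‖y‖² = 1}, where ĝ_j(y) = g_j^h(0, y). -/
def hatS {n s : ℕ} (g : Fin s → MvPolynomial (Fin n) ℝ) : Set (Fin n → ℝ) :=
  {y | (∀ j, 0 ≤ eval (Fin.cons 0 y) (polyHomog (g j).totalDegree (g j))) ∧
    ∑ i, y i ^ 2 = 1}

/-- The polynomial ‖Ỹ‖² = Y₀² + ⋯ + Y_n². -/
noncomputable def normSq (n : ℕ) : MvPolynomial (Fin (n + 1)) ℝ :=
  ∑ i : Fin (n + 1), X i ^ 2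

/-- Membership in the k-th truncated quadratic module Q_k(G^h) generated by
G^h = {g₁^h, …, g_s^h, Y₀, ‖Ỹ‖² − 1, 1 − ‖Ỹ‖²}. -/
def QModMemHK {n s : ℕ} (g : Fin s → MvPolynomial (Fin n) ℝ) (k : ℕ)
    (p : MvPolynomial (Fin (n + 1)) ℝ) : Prop :=
  ∃ (σ₀ : MvPolynomial (Fin (n + 1)) ℝ) (σ : Fin s → MvPolynomial (Fin (n + 1)) ℝ)
    (τ₀ τ₁ τ₂ : MvPolynomial (Fin (n + 1)) ℝ),
    SOSPoly σ₀ ∧ (∀ j, SOSPoly (σ j)) ∧ SOSPoly τ₀ ∧ SOSPoly τ₁ ∧ SOSPoly τ₂ ∧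
    σ₀.totalDegree ≤ 2 * k ∧
    (∀ j, (σ j * polyHomog (g j).totalDegree (g j)).totalDegree ≤ 2 * k) ∧
    (τ₀ * X 0).totalDegree ≤ 2 * k ∧
    (τ₁ * (normSq n - 1)).totalDegree ≤ 2 * k ∧
    (τ₂ * (1 - normSq n)).totalDegree ≤ 2 * k ∧
    p = σ₀ + (∑ j, σ j * polyHomog (g j).totalDegree (g j)) + τ₀ * X 0 +
      τ₁ * (normSq n - 1) + τ₂ * (1 - normSq n)

/-- The k-th SOS relaxation value f̃^sos_k of the homogenized polynomial optimization
problem: sup{ x : f^h − x·Y₀^{D_f} ∈ Q_k(G^h) }, as an extended real. -/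
noncomputable def ftildeSOS {n s : ℕ} (g : Fin s → MvPolynomial (Fin n) ℝ)
    (f : MvPolynomial (Fin n) ℝ) (k : ℕ) : EReal :=
  sSup ((fun x : ℝ => (x : EReal)) ''
    {x | QModMemHK g k (polyHomog f.totalDegree f - C x * X 0 ^ f.totalDegree)})

/-- An Archimedean quadratic module of a commutative real algebra. -/
structure IsArchimedeanQuadraticModule {A : Type*} [CommRing A] [Algebra ℝ A] (Q : Set A) :
    Prop where
  one_mem : 1 ∈ Q
  add_mem : ∀ {a b}, a ∈ Q → b ∈ Q → a + b ∈ Q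
  sq_mul_mem : ∀ (a : A) {b}, b ∈ Q → a ^ 2 * b ∈ Q
  exists_sub_mem : ∀ a, ∃ N : ℝ, algebraMap ℝ A N - a ∈ Q

/-- The normalized linear functionals on `A` that are nonnegative on `Q`. -/
def stateSpace {A : Type*} [CommRing A] [Algebra ℝ A] (Q : Set A) : Set (A → ℝ) :=
  {L | (∀ a b, L (a + b) = L a + L b) ∧ (∀ (c : ℝ) a, L (c • a) = c * L a) ∧ L 1 = 1 ∧
    ∀ q ∈ Q, 0 ≤ L q}

/-- `p` preserves `Q` under multiplication and is bounded above by `c` modulo `Q`. -/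
def IsMultiplierLE {A : Type*} [CommRing A] [Algebra ℝ A] (Q : Set A) (p : A) (c : ℝ) : Prop :=
  (∀ q ∈ Q, p * q ∈ Q) ∧ algebraMap ℝ A c - p ∈ Q

namespace IsArchimedeanQuadraticModule

variable {A : Type*} [CommRing A] [Algebra ℝ A] {Q : Set A}

theorem algebraMap_mul_mem (hQ : IsArchimedeanQuadraticModule Q) {c : ℝ} (hc : 0 ≤ c) {q : A}
    (hq : q ∈ Q) : algebraMap ℝ A c * q ∈ Q := by
  have := hQ.sq_mul_mem (algebraMap ℝ A √c) hq
  rwa [← map_pow, Real.sq_sqrt hc] at this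

theorem algebraMap_mem (hQ : IsArchimedeanQuadraticModule Q) {c : ℝ} (hc : 0 ≤ c) :
    algebraMap ℝ A c ∈ Q := by
  simpa using hQ.algebraMap_mul_mem hc hQ.one_mem

theorem sub_mem_of_le (hQ : IsArchimedeanQuadraticModule Q) {c d : ℝ} (hcd : c ≤ d) {a : A}
    (h : algebraMap ℝ A c - a ∈ Q) : algebraMap ℝ A d - a ∈ Q := by
  have := hQ.add_mem (hQ.algebraMap_mem (sub_nonneg.2 hcd)) h
  rw [map_sub] at this
  convert this using 1
  ring

theorem exists_pos_sub_mem (hQ : IsArchimedeanQuadraticModule Q) (a : A) :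
    ∃ N : ℝ, 0 < N ∧ algebraMap ℝ A N - a ∈ Q := by
  obtain ⟨N, hN⟩ := hQ.exists_sub_mem a
  exact ⟨max N 1, by positivity, hQ.sub_mem_of_le (le_max_left _ _) hN⟩

theorem isMultiplierLE_mono (hQ : IsArchimedeanQuadraticModule Q) {p : A} {c d : ℝ}
    (hp : IsMultiplierLE Q p c) (hcd : c ≤ d) : IsMultiplierLE Q p d :=
  ⟨hp.1, hQ.sub_mem_of_le hcd hp.2⟩

theorem isMultiplierLE_algebraMap (hQ : IsArchimedeanQuadraticModule Q) {c : ℝ} (hc : 0 ≤ c) :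
    IsMultiplierLE Q (algebraMap ℝ A c) c :=
  ⟨fun _ hq ↦ hQ.algebraMap_mul_mem hc hq, by simpa using hQ.algebraMap_mem le_rfl⟩

theorem isMultiplierLE_add (hQ : IsArchimedeanQuadraticModule Q) {p q : A} {c d : ℝ}
    (hp : IsMultiplierLE Q p c) (hq : IsMultiplierLE Q q d) :
    IsMultiplierLE Q (p + q) (c + d) := by
  refine ⟨fun r hr ↦ ?_, ?_⟩
  · rw [add_mul]
    exact hQ.add_mem (hp.1 r hr) (hq.1 r hr)
  · convert hQ.add_mem hp.2 hq.2 using 1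
    rw [map_add]
    ring

theorem isMultiplierLE_mul (hQ : IsArchimedeanQuadraticModule Q) {p q : A} {c d : ℝ}
    (hc : 0 ≤ c) (hp : IsMultiplierLE Q p c) (hq : IsMultiplierLE Q q d) :
    IsMultiplierLE Q (p * q) (c * d) := by
  refine ⟨fun r hr ↦ ?_, ?_⟩
  · rw [mul_assoc]
    exact hp.1 _ (hq.1 r hr)
  · convert hQ.add_mem (hQ.algebraMap_mul_mem hc hq.2) (hq.1 _ hp.2) using 1
    rw [map_mul]
    ring

/-- Newton-type approximation of `√(1 - x)` by `1 - r`, with error `2 * d`. -/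
theorem exists_sq_approx (hQ : IsArchimedeanQuadraticModule Q) {x : A}
    (hx : IsMultiplierLE Q x (1 / 2)) (k : ℕ) :
    ∃ r d : A, IsMultiplierLE Q r (1 / 2 - (1 / 2) ^ k / 2) ∧
      IsMultiplierLE Q d ((1 / 2) ^ k / 4) ∧ 1 - x = (1 - r) ^ 2 - 2 * d := by
  have htwo : (2 : A) * algebraMap ℝ A (1 / 2) = 1 := by
    rw [← map_ofNat (algebraMap ℝ A) 2, ← map_mul]
    norm_num
  have hhalf := hQ.isMultiplierLE_algebraMap (c := 1 / 2) (by norm_num)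
  induction k with
  | zero =>
    refine ⟨0, algebraMap ℝ A (1 / 2) * x, ?_, ?_, ?_⟩
    · simpa using hQ.isMultiplierLE_algebraMap le_rfl
    · exact hQ.isMultiplierLE_mono (hQ.isMultiplierLE_mul (by norm_num) hhalf hx) (by norm_num)
    · linear_combination x * htwo
  | succ k ih =>
    obtain ⟨r, d, hr, hd, h⟩ := ih
    have hpos : (0 : ℝ) < (1 / 2) ^ k := by positivity
    refine ⟨r + d, algebraMap ℝ A (1 / 2) * (d * (r + r + d)), ?_, ?_, ?_⟩
    · exact hQ.isMultiplierLE_mono (hQ.isMultiplierLE_add hr hd) (by rw [pow_succ]; linarith)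
    · refine hQ.isMultiplierLE_mono (hQ.isMultiplierLE_mul (by norm_num) hhalf
        (hQ.isMultiplierLE_mul (by positivity) hd
          (hQ.isMultiplierLE_add (hQ.isMultiplierLE_add hr hr) hd))) ?_
      rw [pow_succ]
      nlinarith
    · linear_combination h + d * (r + r + d) * htwo

theorem add_one_sub_mul_mem (hQ : IsArchimedeanQuadraticModule Q) {x q : A}
    (hx : IsMultiplierLE Q x (1 / 2)) (hq : q ∈ Q) {ε : ℝ} (hε : 0 < ε) :
    algebraMap ℝ A ε + (1 - x) * q ∈ Q := by
  obtain ⟨M, hM0, hM⟩ := hQ.exists_pos_sub_mem q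
  obtain ⟨k, hk⟩ := exists_pow_lt_of_lt_one (div_pos hε hM0) (show (1 / 2 : ℝ) < 1 by norm_num)
  obtain ⟨r, d, -, hd, h⟩ := hQ.exists_sq_approx hx k
  rw [lt_div_iff₀ hM0] at hk
  have hpos : (0 : ℝ) < (1 / 2) ^ k := by positivity
  have h₁ := hQ.sq_mul_mem (1 - r) hq
  have h₂ := hd.1 _ hM
  have h₃ := hQ.algebraMap_mul_mem hM0.le hd.2
  have h₄ := hQ.algebraMap_mem (c := ε - 2 * (M * ((1 / 2) ^ k / 4))) (by nlinarith)
  have h₅ := hQ.add_mem (hQ.add_mem h₁ h₄) (hQ.add_mem (hQ.add_mem h₂ h₂) (hQ.add_mem h₃ h₃))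
  convert h₅ using 1
  simp only [map_sub, map_mul, map_ofNat]
  linear_combination q * h

theorem isMultiplierLE_sq (hQ : IsArchimedeanQuadraticModule Q) (h : A) :
    ∃ t : ℝ, 0 < t ∧ IsMultiplierLE Q (algebraMap ℝ A t * h ^ 2) (1 / 2) := by
  obtain ⟨N, hN0, hN⟩ := hQ.exists_pos_sub_mem (h ^ 2)
  refine ⟨1 / (2 * N), by positivity, fun q hq ↦ ?_, ?_⟩
  · rw [mul_assoc]
    exact hQ.algebraMap_mul_mem (by positivity) (hQ.sq_mul_mem h hq)
  · have := hQ.algebraMap_mul_mem (c := 1 / (2 * N)) (by positivity) hN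
    rw [mul_sub, ← map_mul] at this
    convert this using 3
    field_simp

theorem rescale_mem_stateSpace {L : A → ℝ} (hL : L ∈ stateSpace Q) {y : A} (hy : 0 < L y)
    (hnn : ∀ q ∈ Q, 0 ≤ L (y * q)) : (fun a ↦ (L y)⁻¹ * L (y * a)) ∈ stateSpace Q := by
  obtain ⟨hadd, hsmul, -, -⟩ := hL
  refine ⟨fun a b ↦ ?_, fun c a ↦ ?_, ?_, fun q hq ↦ mul_nonneg (inv_nonneg.2 hy.le) (hnn q hq)⟩
  · simp only [mul_add, hadd]
  · simp only [mul_smul_comm, hsmul]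
    ring
  · simp only [mul_one, inv_mul_cancel₀ hy.ne']

theorem eq_mul_of_extreme_multiplier (hQ : IsArchimedeanQuadraticModule Q) {L : A → ℝ}
    (hL : L ∈ (stateSpace Q).extremePoints ℝ) {x : A} (hx : IsMultiplierLE Q x (1 / 2)) (p : A) :
    L (x * p) = L x * L p := by
  have hmem := hL.1
  obtain ⟨⟨hadd, hsmul, hone, hnn⟩, hext⟩ := hL
  have hC : ∀ c : ℝ, ∀ a, L (algebraMap ℝ A c * a) = c * L a := fun c a ↦ by
    rw [← Algebra.smul_def, hsmul]
  have hsub : ∀ a b, L (a - b) = L a - L b := fun a b ↦ by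
    have := hadd (a - b) b
    rw [sub_add_cancel] at this
    linarith
  have hCone : ∀ c : ℝ, L (algebraMap ℝ A c) = c := fun c ↦ by
    have := hC c 1
    rwa [mul_one, hone, mul_one] at this
  have hx0 : 0 ≤ L x := by simpa using hnn _ (hx.1 1 hQ.one_mem)
  have hx1 : L x ≤ 1 / 2 := by
    have := hnn _ hx.2
    rw [hsub, hCone] at this
    linarith
  have hcompl : ∀ q ∈ Q, 0 ≤ L ((1 - x) * q) := fun q hq ↦ by
    refine le_of_forall_pos_le_add fun ε hε ↦ ?_
    have := hnn _ (hQ.add_one_sub_mul_mem hx hq hε)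
    rw [hadd, hCone] at this
    linarith
  rcases hx0.eq_or_lt with h0 | h0
  · have hzero : ∀ q ∈ Q, L (x * q) = 0 := fun q hq ↦ by
      obtain ⟨M, -, hM⟩ := hQ.exists_pos_sub_mem q
      have h₁ := hnn _ (hx.1 _ hM)
      have h₂ := hnn _ (hx.1 _ hq)
      rw [mul_sub, hsub, mul_comm x (algebraMap ℝ A M), hC, ← h0] at h₁
      linarith
    obtain ⟨N, -, hN⟩ := hQ.exists_pos_sub_mem p
    have := hzero _ hN
    rw [mul_sub, hsub, mul_comm x (algebraMap ℝ A N), hC, ← h0] at this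
    rw [← h0]
    linarith
  · have h1 : 0 < 1 - L x := by linarith
    have hLcompl : L (1 - x) = 1 - L x := by rw [hsub, hone]
    have hmem₁ := rescale_mem_stateSpace hmem h0 fun q hq ↦ hnn _ (hx.1 _ hq)
    have hmem₂ := rescale_mem_stateSpace hmem (hLcompl ▸ h1) hcompl
    have hseg := hext hmem₁ hmem₂ ⟨L x, 1 - L x, h0, h1, by ring, by
      funext a
      simp only [Pi.add_apply, Pi.smul_apply, smul_eq_mul, hLcompl]
      rw [mul_inv_cancel_left₀ h0.ne', mul_inv_cancel_left₀ h1.ne', sub_mul, one_mul, hsub]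
      ring⟩
    rw [← congrFun hseg p, mul_inv_cancel_left₀ h0.ne']

/-- Extreme states are multiplicative. -/
theorem map_mul_of_extreme (hQ : IsArchimedeanQuadraticModule Q) {L : A → ℝ}
    (hL : L ∈ (stateSpace Q).extremePoints ℝ) (a p : A) : L (a * p) = L a * L p := by
  obtain ⟨hadd, hsmul, -, -⟩ := hL.1
  have hC : ∀ c : ℝ, ∀ a, L (algebraMap ℝ A c * a) = c * L a := fun c a ↦ by
    rw [← Algebra.smul_def, hsmul]
  have hsq : ∀ h : A, L (h ^ 2 * p) = L (h ^ 2) * L p := fun h ↦ by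
    obtain ⟨t, ht, hm⟩ := hQ.isMultiplierLE_sq h
    have := hQ.eq_mul_of_extreme_multiplier hL hm p
    rw [mul_assoc, hC, hC, mul_assoc] at this
    exact mul_left_cancel₀ ht.ne' this
  have h₁ : L ((a + 1) ^ 2) = L ((a - 1) ^ 2) + 4 * L a := by
    rw [← hsmul, ← hadd, Algebra.smul_def, map_ofNat]
    congr 1
    ring
  have h₂ : L ((a + 1) ^ 2 * p) = L ((a - 1) ^ 2 * p) + 4 * L (a * p) := by
    rw [← hsmul, ← hadd, Algebra.smul_def, map_ofNat]
    congr 1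
    ring
  rw [hsq, hsq, h₁] at h₂
  linarith

theorem isCompact_stateSpace (hQ : IsArchimedeanQuadraticModule Q) :
    IsCompact (stateSpace Q) := by
  choose N hN using hQ.exists_sub_mem
  refine (isCompact_univ_pi fun a ↦ isCompact_Icc (a := -N (-a)) (b := N a)).of_isClosed_subset
    ?_ ?_
  · simp only [stateSpace, Set.ofPred_and, Set.ofPred_forall]
    refine .inter (isClosed_iInter fun a ↦ isClosed_iInter fun b ↦ isClosed_eq ?_ ?_)
      (.inter (isClosed_iInter fun c ↦ isClosed_iInter fun a ↦ isClosed_eq ?_ ?_)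
      (.inter (isClosed_eq ?_ ?_) (isClosed_iInter fun q ↦ isClosed_iInter fun _ ↦
        isClosed_le ?_ ?_))) <;> fun_prop
  · rintro L ⟨hadd, hsmul, hone, hnn⟩ a -
    have hC : ∀ c : ℝ, L (algebraMap ℝ A c) = c := fun c ↦ by
      rw [Algebra.algebraMap_eq_smul_one, hsmul, hone, mul_one]
    have hneg : L (-a) = -L a := by simpa using hsmul (-1) a
    have h₁ := hnn _ (hN a)
    have h₂ := hnn _ (hN (-a))
    rw [sub_eq_add_neg, hadd, hC] at h₁ h₂
    rw [neg_neg] at h₂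
    exact ⟨by linarith, by linarith⟩

theorem mem_of_neg_one_mem (hQ : IsArchimedeanQuadraticModule Q) (h : -1 ∈ Q) (a : A) :
    a ∈ Q := by
  obtain ⟨N, hN0, hN⟩ := hQ.exists_pos_sub_mem (-a)
  convert hQ.add_mem hN (hQ.algebraMap_mul_mem hN0.le h) using 1
  ring

/-- An element outside `Q` is separated from `Q` by a state. -/
theorem exists_state_nonpos (hQ : IsArchimedeanQuadraticModule Q) {f : A} (hf : f ∉ Q) :
    ∃ L ∈ stateSpace Q, L f ≤ 0 := by
  have hzero : (0 : A) ∈ Q := by simpa using hQ.algebraMap_mem le_rfl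
  let K : PointedCone ℝ A :=
    { carrier := {a | ∃ q ∈ Q, ∃ c : ℝ, 0 ≤ c ∧ a = q - c • f}
      add_mem' := by
        rintro _ _ ⟨q, hq, c, hc, rfl⟩ ⟨q', hq', c', hc', rfl⟩
        exact ⟨q + q', hQ.add_mem hq hq', c + c', by positivity, by module⟩
      zero_mem' := ⟨0, hzero, 0, le_rfl, by simp⟩
      smul_mem' := by
        rintro ⟨t, ht⟩ _ ⟨q, hq, c, hc, rfl⟩
        refine ⟨t • q, ?_, t * c, by positivity, ?_⟩
        · rw [Algebra.smul_def]
          exact hQ.algebraMap_mul_mem ht hq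
        · change t • (q - c • f) = _
          module }
  have hK : ∀ q ∈ Q, q ∈ K := fun q hq ↦ ⟨q, hq, 0, le_rfl, by simp⟩
  have hneg : ∀ t : ℝ, t • (1 : A) ∈ K → 0 ≤ t := by
    rintro t ⟨q, hq, c, hc, h⟩
    by_contra! ht
    have hmem : c • f ∈ Q := by
      have h' : c • f = q + algebraMap ℝ A (-t) := by
        rw [Algebra.algebraMap_eq_smul_one, neg_smul, h]
        abel
      rw [h']
      exact hQ.add_mem hq (hQ.algebraMap_mem (by linarith))
    rcases hc.eq_or_lt with rfl | hc
    · refine hf (hQ.mem_of_neg_one_mem ?_ f)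
      rw [zero_smul, sub_zero] at h
      have := hQ.algebraMap_mul_mem (c := -t⁻¹) (neg_nonneg.2 (inv_nonpos.2 ht.le)) hq
      rwa [← h, ← Algebra.smul_def, smul_smul, neg_mul, inv_mul_cancel₀ ht.ne, neg_smul,
        one_smul] at this
    · refine hf ?_
      have := hQ.algebraMap_mul_mem (c := c⁻¹) (by positivity) hmem
      rwa [← Algebra.smul_def, smul_smul, inv_mul_cancel₀ hc.ne', one_smul] at this
  have hwd : ∀ c : ℝ, c • (1 : A) = 0 → RingHom.id ℝ c • (1 : ℝ) = 0 := fun c hc ↦ by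
    have h₁ := hneg c (by rw [hc]; exact K.zero_mem)
    have h₂ := hneg (-c) (by rw [neg_smul, hc, neg_zero]; exact K.zero_mem)
    simp only [RingHom.id_apply, smul_eq_mul, mul_one]
    linarith
  obtain ⟨L, hL, hLK⟩ := riesz_extension K (LinearPMap.mkSpanSingleton' (1 : A) (1 : ℝ) hwd)
    (by
      rintro ⟨a, ha⟩ haK
      obtain ⟨c, rfl⟩ := Submodule.mem_span_singleton.1 ha
      rw [LinearPMap.mkSpanSingleton'_apply]
      simpa using hneg c haK)
    (fun y ↦ by
      obtain ⟨N, -, hN⟩ := hQ.exists_pos_sub_mem (-y)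
      refine ⟨⟨N • 1, Submodule.mem_span_singleton.2 ⟨N, rfl⟩⟩, hK _ ?_⟩
      rwa [sub_neg_eq_add, Algebra.algebraMap_eq_smul_one] at hN)
  refine ⟨L, ⟨fun a b ↦ map_add L a b, fun c a ↦ by simp, ?_, fun q hq ↦ hLK q (hK q hq)⟩, ?_⟩
  · exact (hL ⟨1, Submodule.mem_span_singleton_self 1⟩).trans
      (LinearPMap.mkSpanSingleton'_apply_self _ _ _ _)
  · have := hLK (-f) ⟨0, hzero, 1, zero_le_one, by simp⟩
    rw [map_neg] at this
    linarith

/-- **Representation theorem** for Archimedean quadratic modules: an element which is positive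
under every character that is nonnegative on `Q` belongs to `Q`. -/
theorem mem_of_forall_algHom_pos (hQ : IsArchimedeanQuadraticModule Q) {f : A}
    (hf : ∀ φ : A →ₐ[ℝ] ℝ, (∀ q ∈ Q, 0 ≤ φ q) → 0 < φ f) : f ∈ Q := by
  by_contra hfQ
  obtain ⟨L₀, hL₀, hL₀f⟩ := hQ.exists_state_nonpos hfQ
  let B : Set (A → ℝ) := {L ∈ stateSpace Q | ∀ L' ∈ stateSpace Q, L f ≤ L' f}
  have hB : IsExposed ℝ (stateSpace Q) B := fun _ ↦
    ⟨-ContinuousLinearMap.proj (R := ℝ) (φ := fun _ : A ↦ ℝ) f, by ext L; simp [B]⟩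
  obtain ⟨L₁, hL₁, hmin⟩ := hQ.isCompact_stateSpace.exists_isMinOn ⟨L₀, hL₀⟩
    (continuous_apply f).continuousOn
  obtain ⟨L, hL⟩ := (hB.isCompact hQ.isCompact_stateSpace).extremePoints_nonempty
    ⟨L₁, hL₁, fun L' hL' ↦ hmin hL'⟩
  have hLext := hB.isExtreme.extremePoints_subset_extremePoints hL
  obtain ⟨⟨hadd, hsmul, hone, hnn⟩, hLmin⟩ := hL.1
  have := hf (AlgHom.ofLinearMap ⟨⟨L, hadd⟩, fun c a ↦ hsmul c a⟩ hone
    fun a b ↦ hQ.map_mul_of_extreme hLext a b) hnn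
  exact this.not_ge ((hLmin L₀ hL₀).trans hL₀f)

end IsArchimedeanQuadraticModule

namespace SOSPoly

variable {n : ℕ} {p q : MvPolynomial (Fin n) ℝ}

theorem sq (a : MvPolynomial (Fin n) ℝ) : SOSPoly (a ^ 2) := ⟨1, fun _ ↦ a, by simp⟩

theorem zero : SOSPoly (0 : MvPolynomial (Fin n) ℝ) := ⟨0, Fin.elim0, by simp⟩

theorem add (hp : SOSPoly p) (hq : SOSPoly q) : SOSPoly (p + q) := by
  obtain ⟨t, a, rfl⟩ := hp
  obtain ⟨u, b, rfl⟩ := hq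
  exact ⟨t + u, Fin.append a b, by simp [Fin.sum_univ_add]⟩

theorem sum {ι : Type*} (s : Finset ι) {p : ι → MvPolynomial (Fin n) ℝ}
    (hp : ∀ i ∈ s, SOSPoly (p i)) : SOSPoly (∑ i ∈ s, p i) :=
  Finset.sum_induction p SOSPoly (fun _ _ ↦ add) zero hp

theorem sq_mul (a : MvPolynomial (Fin n) ℝ) (hp : SOSPoly p) : SOSPoly (a ^ 2 * p) := by
  obtain ⟨t, b, rfl⟩ := hp
  exact ⟨t, fun i ↦ a * b i, by simp [Finset.mul_sum, mul_pow]⟩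

theorem eval_nonneg (hp : SOSPoly p) (y : Fin n → ℝ) : 0 ≤ eval y p := by
  obtain ⟨t, b, rfl⟩ := hp
  simp only [map_sum, map_pow]
  positivity

end SOSPoly

namespace QModMem

variable {n s : ℕ} {g : Fin s → MvPolynomial (Fin n) ℝ} {a b p q : MvPolynomial (Fin n) ℝ}

theorem of_sos (hp : SOSPoly p) : QModMem g p :=
  ⟨p, 0, hp, fun _ ↦ SOSPoly.zero, by simp⟩

theorem generator_mem (j : Fin s) : QModMem g (g j) := by
  refine ⟨0, Pi.single j 1, SOSPoly.zero, fun i ↦ ?_, ?_⟩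
  · obtain rfl | h := eq_or_ne i j
    · simpa using SOSPoly.sq 1
    · simpa [h] using SOSPoly.zero
  · rw [Finset.sum_eq_single j (fun i _ h ↦ by simp [h]) (by simp)]
    simp

theorem add (hp : QModMem g p) (hq : QModMem g q) : QModMem g (p + q) := by
  obtain ⟨σ₀, σ, h₀, h, rfl⟩ := hp
  obtain ⟨τ₀, τ, h₀', h', rfl⟩ := hq
  refine ⟨σ₀ + τ₀, fun j ↦ σ j + τ j, h₀.add h₀', fun j ↦ (h j).add (h' j), ?_⟩
  simp only [add_mul, Finset.sum_add_distrib]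
  ring

theorem sq_mul (a : MvPolynomial (Fin n) ℝ) (hp : QModMem g p) : QModMem g (a ^ 2 * p) := by
  obtain ⟨σ₀, σ, h₀, h, rfl⟩ := hp
  refine ⟨a ^ 2 * σ₀, fun j ↦ a ^ 2 * σ j, h₀.sq_mul a, fun j ↦ (h j).sq_mul a, ?_⟩
  simp only [mul_add, Finset.mul_sum, mul_assoc]

theorem C_mul {c : ℝ} (hc : 0 ≤ c) (hp : QModMem g p) : QModMem g (C c * p) := by
  have := hp.sq_mul (C √c)
  rwa [← map_pow, Real.sq_sqrt hc] at this

theorem C_mem {c : ℝ} (hc : 0 ≤ c) : QModMem g (C c) := by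
  simpa using C_mul (g := g) hc (of_sos (SOSPoly.sq 1))

theorem sq_le {N : ℝ} (hN : 0 < N) (h₁ : QModMem g (C N - a)) (h₂ : QModMem g (C N + a)) :
    QModMem g (C (N ^ 2) - a ^ 2) := by
  have h := ((h₂.sq_mul (C N - a)).add (h₁.sq_mul (C N + a))).C_mul
    (c := (2 * N)⁻¹) (by positivity)
  have hC : (C (2 * N)⁻¹ : MvPolynomial (Fin n) ℝ) * (2 * C N) = 1 := by
    rw [← map_ofNat C 2, ← map_mul, ← map_mul, inv_mul_cancel₀ (by positivity), map_one]
  convert h using 1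
  rw [map_pow]
  linear_combination -(C N ^ 2 - a ^ 2) * hC

/-- If `C N - ∑ X i ^ 2` lies in the quadratic module, every polynomial is bounded modulo it. -/
theorem exists_bound {N : ℝ} (hN : QModMem g (C N - ∑ i, X i ^ 2))
    (p : MvPolynomial (Fin n) ℝ) :
    ∃ M : ℝ, 0 < M ∧ QModMem g (C M - p) ∧ QModMem g (C M + p) := by
  have hmul : ∀ p q : MvPolynomial (Fin n) ℝ,
      (∃ M : ℝ, 0 < M ∧ QModMem g (C M - p) ∧ QModMem g (C M + p)) →
      (∃ M : ℝ, 0 < M ∧ QModMem g (C M - q) ∧ QModMem g (C M + q)) →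
      ∃ M : ℝ, 0 < M ∧ QModMem g (C M - p * q) ∧ QModMem g (C M + p * q) := by
    rintro p q ⟨M, hM, hp₁, hp₂⟩ ⟨K, hK, hq₁, hq₂⟩
    have hC : (C (1 / 2) : MvPolynomial (Fin n) ℝ) * 2 = 1 := by
      rw [← map_ofNat C 2, ← map_mul]
      norm_num
    have hpq := (sq_le hM hp₁ hp₂).add (sq_le hK hq₁ hq₂)
    refine ⟨1 / 2 * (M ^ 2 + K ^ 2), by positivity, ?_, ?_⟩
    · convert (hpq.add (of_sos (SOSPoly.sq (p - q)))).C_mul (c := 1 / 2) (by norm_num) using 1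
      rw [map_mul, map_add]
      linear_combination (p * q) * hC
    · convert (hpq.add (of_sos (SOSPoly.sq (p + q)))).C_mul (c := 1 / 2) (by norm_num) using 1
      rw [map_mul, map_add]
      linear_combination -(p * q) * hC
  induction p using MvPolynomial.induction_on with
  | C c =>
    refine ⟨|c| + 1, by positivity, ?_, ?_⟩
    · rw [← map_sub]
      exact C_mem (by linarith [le_abs_self c])
    · rw [← map_add]
      exact C_mem (by linarith [neg_abs_le c])
  | add p q hp hq =>
    obtain ⟨M, hM, hp₁, hp₂⟩ := hp
    obtain ⟨K, hK, hq₁, hq₂⟩ := hq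
    refine ⟨M + K, by positivity, ?_, ?_⟩
    · convert hp₁.add hq₁ using 1
      rw [map_add]
      ring
    · convert hp₂.add hq₂ using 1
      rw [map_add]
      ring
  | mul_X p i hp =>
    refine hmul _ _ hp ?_
    have hi : QModMem g (C N - X i ^ 2) := by
      have hrest : SOSPoly (∑ j ∈ Finset.univ.erase i, (X j : MvPolynomial (Fin n) ℝ) ^ 2) :=
        SOSPoly.sum _ fun j _ ↦ SOSPoly.sq _
      convert hN.add (of_sos hrest) using 1
      rw [← Finset.add_sum_erase _ _ (Finset.mem_univ i)]
      ring
    have hbound : ∀ x : MvPolynomial (Fin n) ℝ, QModMem g (C N - x ^ 2) →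
        QModMem g (C (|N| + 1) - x) := fun x hx ↦ by
      have hC : (C (1 / 2) : MvPolynomial (Fin n) ℝ) * 2 = 1 := by
        rw [← map_ofNat C 2, ← map_mul]
        norm_num
      have h₀ : 0 ≤ |N| + 1 - N - (1 / 2) ^ 2 := by linarith [le_abs_self N]
      convert (hx.add (of_sos (SOSPoly.sq (x - C (1 / 2))))).add (C_mem h₀) using 1
      rw [map_sub _ _ ((1 / 2) ^ 2), map_sub _ _ N, map_pow]
      linear_combination x * hC
    refine ⟨|N| + 1, by positivity, hbound _ hi, ?_⟩
    have := hbound (-X i) (by rwa [neg_sq])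
    rwa [sub_neg_eq_add] at this

theorem isArchimedeanQuadraticModule {N : ℝ} (hN : QModMem g (C N - ∑ i, X i ^ 2)) :
    IsArchimedeanQuadraticModule {p | QModMem g p} where
  one_mem := by simpa using C_mem (g := g) zero_le_one
  add_mem := add
  sq_mul_mem a _ hb := hb.sq_mul a
  exists_sub_mem a := by
    obtain ⟨M, -, hM, -⟩ := exists_bound hN a
    exact ⟨M, hM⟩

/-- **Putinar's Positivstellensatz**. -/
theorem of_forall_indexSet_pos {N : ℝ} (hN : QModMem g (C N - ∑ i, X i ^ 2))
    {f : MvPolynomial (Fin n) ℝ} (hf : ∀ y ∈ indexSet g, 0 < eval y f) : QModMem g f := by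
  refine (isArchimedeanQuadraticModule hN).mem_of_forall_algHom_pos (f := f) fun φ hφ ↦ ?_
  have hφ_eval : ∀ p, φ p = eval (φ ∘ X) p := fun p ↦ by
    conv_lhs => rw [aeval_unique φ]
    rw [← coe_aeval_eq_eval]
    rfl
  rw [hφ_eval]
  refine hf _ fun j ↦ ?_
  rw [← hφ_eval]
  exact hφ _ (generator_mem j)

end QModMem

section Homogenization

variable {n s : ℕ}

theorem eval_polyHomog (D : ℕ) (f : MvPolynomial (Fin n) ℝ) (y : Fin (n + 1) → ℝ) :
    eval y (polyHomog D f) = ∑ α ∈ f.support,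
      f.coeff α * (y 0 ^ (D - ∑ i, α i) * ∏ i, y i.succ ^ α i) := by
  rw [polyHomog, map_sum]
  refine Finset.sum_congr rfl fun α _ ↦ ?_
  rw [eval_monomial, Finsupp.prod_add_index' (by simp) (fun _ _ _ ↦ pow_add _ _ _),
    Finsupp.prod_single_index (by simp),
    Finsupp.prod_mapDomain_index (by simp) (fun _ _ _ ↦ pow_add _ _ _),
    Finsupp.prod_fintype _ _ (by simp)]

theorem eval_mul_cons_polyHomog {D : ℕ} {f : MvPolynomial (Fin n) ℝ} (hD : f.totalDegree ≤ D)
    (c : ℝ) (u : Fin n → ℝ) :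
    eval (fun i ↦ c * (Fin.cons 1 u : Fin (n + 1) → ℝ) i) (polyHomog D f) =
      c ^ D * eval u f := by
  rw [eval_polyHomog, eval_eq', Finset.mul_sum]
  refine Finset.sum_congr rfl fun α hα ↦ ?_
  have hdeg : ∑ i, α i ≤ D := by
    rw [← Finsupp.sum_fintype α (fun _ e ↦ e) (by simp)]
    exact (le_totalDegree hα).trans hD
  simp only [Fin.cons_zero, Fin.cons_succ, mul_one, mul_pow, Finset.prod_mul_distrib,
    Finset.prod_pow_eq_pow_sum]
  rw [← mul_assoc (c ^ _), ← pow_add, Nat.sub_add_cancel hdeg]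
  ring

theorem eval_polyHomog_of_totalDegree_eq_zero {f : MvPolynomial (Fin n) ℝ}
    (hf : f.totalDegree = 0) (y : Fin (n + 1) → ℝ) (u : Fin n → ℝ) :
    eval y (polyHomog f.totalDegree f) = eval u f := by
  rw [eval_polyHomog, eval_eq', hf]
  refine Finset.sum_congr rfl fun α hα ↦ ?_
  have hα0 : α = 0 := by
    have := le_totalDegree hα
    rw [hf, Nat.le_zero, Finsupp.sum_fintype _ _ (by simp), Finset.sum_eq_zero_iff] at this
    ext i
    simpa using this i
  simp [hα0]

theorem eq_mul_cons {y : Fin (n + 1) → ℝ} (hy : y 0 ≠ 0) :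
    y = fun i ↦ y 0 * (Fin.cons 1 (fun j : Fin n ↦ y j.succ / y 0) : Fin (n + 1) → ℝ) i := by
  ext i
  refine Fin.cases ?_ (fun j ↦ ?_) i
  · simp
  · simp [mul_div_cancel₀ _ hy]

theorem exists_mul_cons_mem_tildeS {g : Fin s → MvPolynomial (Fin n) ℝ} {u : Fin n → ℝ}
    (hu : u ∈ indexSet g) :
    ∃ r : ℝ, 0 < r ∧ (fun i ↦ r * (Fin.cons 1 u : Fin (n + 1) → ℝ) i) ∈ tildeS g := by
  have hpos : 0 < 1 + ∑ i, u i ^ 2 := by positivity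
  refine ⟨(√(1 + ∑ i, u i ^ 2))⁻¹, by positivity, fun j ↦ ?_, ?_, ?_⟩
  · rw [eval_mul_cons_polyHomog le_rfl]
    exact mul_nonneg (by positivity) (hu j)
  · simp
  · simp only [mul_pow, ← Finset.mul_sum, Fin.sum_univ_succ, Fin.cons_zero, Fin.cons_succ,
      inv_pow, one_pow]
    rw [Real.sq_sqrt hpos.le, inv_mul_cancel₀ hpos.ne']

theorem div_mem_indexSet {g : Fin s → MvPolynomial (Fin n) ℝ} {y : Fin (n + 1) → ℝ}
    (hy : y ∈ tildeS g) (h0 : 0 < y 0) : (fun j : Fin n ↦ y j.succ / y 0) ∈ indexSet g := by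
  intro j
  have h := hy.1 j
  rw [eq_mul_cons h0.ne', eval_mul_cons_polyHomog le_rfl] at h
  exact nonneg_of_mul_nonneg_right h (by positivity)

theorem tail_mem_hatS {g : Fin s → MvPolynomial (Fin n) ℝ} {y : Fin (n + 1) → ℝ}
    (hy : y ∈ tildeS g) (h0 : y 0 = 0) : (fun j : Fin n ↦ y j.succ) ∈ hatS g := by
  have hcons : (Fin.cons 0 (fun j : Fin n ↦ y j.succ) : Fin (n + 1) → ℝ) = y := by
    rw [← h0]
    exact Fin.cons_self_tail y
  refine ⟨fun j ↦ ?_, ?_⟩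
  · rw [hcons]
    exact hy.1 j
  · simpa [Fin.sum_univ_succ, h0] using hy.2.2

variable {g : Fin s → MvPolynomial (Fin n) ℝ} {f : MvPolynomial (Fin n) ℝ} {fstar : ℝ}

/-- Below the infimum of `f` on `S`, the homogenized constraint is strict on `S̃`. -/
theorem eval_polyHomog_sub_pos
    (hglb : IsGLB {v : ℝ | ∃ y ∈ indexSet g, v = eval y f} fstar)
    (hpos : ∀ y ∈ hatS g, 0 < eval (Fin.cons 0 y) (polyHomog f.totalDegree f))
    {x : ℝ} (hx : x < fstar) {y : Fin (n + 1) → ℝ} (hy : y ∈ tildeS g) :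
    0 < eval y (polyHomog f.totalDegree f) - x * y 0 ^ f.totalDegree := by
  have hlt : ∀ u ∈ indexSet g, x < eval u f := fun u hu ↦ hx.trans_le (hglb.1 ⟨u, hu, rfl⟩)
  rcases hy.2.1.eq_or_lt with h0 | h0
  · obtain hD | hD := Nat.eq_zero_or_pos f.totalDegree
    · obtain ⟨_, u, hu, -⟩ := hglb.nonempty
      rw [eval_polyHomog_of_totalDegree_eq_zero hD y u, hD, pow_zero, mul_one]
      exact sub_pos.2 (hlt u hu)
    · have h := hpos _ (tail_mem_hatS hy h0.symm)
      have hcons : (Fin.cons 0 (fun j : Fin n ↦ y j.succ) : Fin (n + 1) → ℝ) = y := by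
        conv_lhs => rw [h0]
        exact Fin.cons_self_tail y
      rw [hcons] at h
      simpa [← h0, hD.ne'] using h
  · have h := eval_mul_cons_polyHomog (f := f) le_rfl (y 0) fun j ↦ y j.succ / y 0
    rw [← eq_mul_cons h0.ne'] at h
    rw [h, mul_comm x, ← mul_sub]
    exact mul_pos (by positivity) (sub_pos.2 (hlt _ (div_mem_indexSet hy h0)))

theorem le_of_forall_tildeS
    (hglb : IsGLB {v : ℝ | ∃ y ∈ indexSet g, v = eval y f} fstar) {x : ℝ}
    (hx : ∀ y ∈ tildeS g, 0 ≤ eval y (polyHomog f.totalDegree f) - x * y 0 ^ f.totalDegree) :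
    x ≤ fstar := by
  refine hglb.2 ?_
  rintro _ ⟨u, hu, rfl⟩
  obtain ⟨r, hr, hmem⟩ := exists_mul_cons_mem_tildeS hu
  have h := hx _ hmem
  rw [eval_mul_cons_polyHomog le_rfl] at h
  simp only [Fin.cons_zero, mul_one] at h
  rw [mul_comm x, ← mul_sub] at h
  exact sub_nonneg.1 (nonneg_of_mul_nonneg_right h (by positivity))

end Homogenization

namespace QModMemHK

variable {n s : ℕ} {g : Fin s → MvPolynomial (Fin n) ℝ} {p : MvPolynomial (Fin (n + 1)) ℝ}

theorem mono {k l : ℕ} (hkl : k ≤ l) (h : QModMemHK g k p) : QModMemHK g l p := by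
  obtain ⟨σ₀, σ, τ₀, τ₁, τ₂, h₀, h, ht₀, ht₁, ht₂, d₀, d, e₀, e₁, e₂, hp⟩ := h
  exact ⟨σ₀, σ, τ₀, τ₁, τ₂, h₀, h, ht₀, ht₁, ht₂, by lia, fun j ↦ by have := d j; lia,
    by lia, by lia, by lia, hp⟩

theorem eval_nonneg {k : ℕ} (h : QModMemHK g k p) {y : Fin (n + 1) → ℝ} (hy : y ∈ tildeS g) :
    0 ≤ eval y p := by
  obtain ⟨σ₀, σ, τ₀, τ₁, τ₂, h₀, h, ht₀, -, -, -, -, -, -, -, rfl⟩ := h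
  have hnorm : eval y (normSq n) = 1 := by simpa [normSq] using hy.2.2
  simp only [map_add, map_mul, map_sub, map_sum, map_one, eval_X, hnorm, sub_self, mul_zero,
    add_zero]
  exact add_nonneg (add_nonneg (h₀.eval_nonneg y) (Finset.sum_nonneg fun j _ ↦
    mul_nonneg ((h j).eval_nonneg y) (hy.1 j))) (mul_nonneg (ht₀.eval_nonneg y) hy.2.1)

theorem exists_of_forall_tildeS_pos (hp : ∀ y ∈ tildeS g, 0 < eval y p) :
    ∃ k, QModMemHK g k p := by
  let G : Fin (s + 3) → MvPolynomial (Fin (n + 1)) ℝ :=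
    Fin.append (fun j ↦ polyHomog (g j).totalDegree (g j)) ![X 0, normSq n - 1, 1 - normSq n]
  have hG₀ : G (Fin.natAdd s 0) = X 0 := by simp [G]
  have hG₁ : G (Fin.natAdd s 1) = normSq n - 1 := by simp [G]
  have hG₂ : G (Fin.natAdd s 2) = 1 - normSq n := by simp [G]
  have hG : ∀ j, G (Fin.castAdd 3 j) = polyHomog (g j).totalDegree (g j) := fun j ↦ by simp [G]
  have harch : QModMem G (C 1 - ∑ i, X i ^ 2) := by
    rw [map_one]
    exact hG₂ ▸ QModMem.generator_mem (g := G) (Fin.natAdd s 2)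
  obtain ⟨σ₀, σ, h₀, h, rfl⟩ := QModMem.of_forall_indexSet_pos harch fun y hy ↦ hp y <| by
    have h₀ := hy (Fin.natAdd s 0)
    have h₁ := hy (Fin.natAdd s 1)
    have h₂ := hy (Fin.natAdd s 2)
    rw [hG₀, eval_X] at h₀
    rw [hG₁] at h₁
    rw [hG₂] at h₂
    simp only [normSq, map_sub, map_sum, map_pow, eval_X, map_one] at h₁ h₂
    exact ⟨fun j ↦ hG j ▸ hy (Fin.castAdd 3 j), h₀, by linarith⟩
  let K : ℕ := σ₀.totalDegree + ∑ j, (σ j * G j).totalDegree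
  have hK : ∀ j, (σ j * G j).totalDegree ≤ 2 * K := fun j ↦ by
    have := Finset.single_le_sum (f := fun j ↦ (σ j * G j).totalDegree)
      (fun _ _ ↦ Nat.zero_le _) (Finset.mem_univ j)
    lia
  refine ⟨K, σ₀, fun j ↦ σ (Fin.castAdd 3 j), σ (Fin.natAdd s 0), σ (Fin.natAdd s 1),
    σ (Fin.natAdd s 2), h₀, fun j ↦ h _, h _, h _, h _, by lia, fun j ↦ hG j ▸ hK _,
    hG₀ ▸ hK _, hG₁ ▸ hK _, hG₂ ▸ hK _, ?_⟩
  rw [Fin.sum_univ_add, Fin.sum_univ_three, hG₀, hG₁, hG₂]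
  simp only [hG]
  ring

end QModMemHK

/-- if f̂ > 0 on Ŝ, then f̃* = f* (f* is the supremum of the x with
f^h − x y₀^{D_f} ≥ 0 on S̃), and the relaxation values f̃^sos_k converge to f*. -/
theorem stmt19 {n s : ℕ} (g : Fin s → MvPolynomial (Fin n) ℝ)
    (f : MvPolynomial (Fin n) ℝ) (fstar : ℝ)
    (hglb : IsGLB {v : ℝ | ∃ y ∈ indexSet g, v = eval y f} fstar)
    (hpos : ∀ y ∈ hatS g, 0 < eval (Fin.cons 0 y) (polyHomog f.totalDegree f)) :
    IsLUB {x : ℝ | ∀ yt ∈ tildeS g,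
        0 ≤ eval yt (polyHomog f.totalDegree f) - x * (yt 0) ^ f.totalDegree} fstar ∧
      Filter.Tendsto (ftildeSOS g f) Filter.atTop (nhds (fstar : EReal)) := by
  have heval : ∀ (x : ℝ) (y : Fin (n + 1) → ℝ),
      eval y (polyHomog f.totalDegree f - C x * X 0 ^ f.totalDegree) =
        eval y (polyHomog f.totalDegree f) - x * y 0 ^ f.totalDegree := by simp
  refine ⟨⟨fun x hx ↦ le_of_forall_tildeS hglb hx, fun b hb ↦ le_of_forall_lt fun x hx ↦ ?_⟩,
    tendsto_order.2 ⟨fun a ha ↦ ?_, fun b hb ↦ .of_forall fun k ↦ lt_of_le_of_lt ?_ hb⟩⟩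
  · obtain ⟨z, hxz, hz⟩ := exists_between hx
    exact hxz.trans_le (hb fun y hy ↦ (eval_polyHomog_sub_pos hglb hpos hz hy).le)
  · obtain ⟨x, hax, hx⟩ := EReal.lt_iff_exists_real_btwn.1 ha
    obtain ⟨k, hk⟩ := QModMemHK.exists_of_forall_tildeS_pos fun y hy ↦ (heval x y).symm ▸
      eval_polyHomog_sub_pos hglb hpos (EReal.coe_lt_coe_iff.1 hx) hy
    filter_upwards [Filter.eventually_ge_atTop k] with l hl
    exact hax.trans_le (le_sSup ⟨x, hk.mono hl, rfl⟩)
  · refine sSup_le ?_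
    rintro _ ⟨x, hx, rfl⟩
    exact EReal.coe_le_coe_iff.2
      (le_of_forall_tildeS hglb fun y hy ↦ heval x y ▸ QModMemHK.eval_nonneg hx hy)
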